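/- arXiv:2110.07099 — 2 statements merged into one kernel-verified Lean document; each statement's English description precedes it below -/
import Mathlib

section
/- Theorem 1 (operator bound for the non-staggered energy-based DG method): With the notation of the context, for all broken functions w, φ of degree q_u − 1 and v, ψ of degree q_v, the bilinear form satisfies B(w,v;φ,ψ) ≤ (c/h) · [ 2√3 · max{(q_u−1)², q_v²} + 2 · ( 2·max{ c·β·q_u², (τ/c)·(q_v+1)² } + (|α| + |1−α|)·(q_v+1)·q_u ) ] · (c²‖w‖² + ‖v‖²)^{1/2} · (c²‖φ‖² + ‖ψ‖²)^{1/2}. -/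
open Polynomial

/-- Squared L² norm of a broken (piecewise polynomial) function on a periodic grid
of `N` elements each of width `h`, in local coordinates `s ∈ [0,h]`. -/
noncomputable def brokenNormSq (N : ℕ) [NeZero N] (h : ℝ)
    (p : ZMod N → Polynomial ℝ) : ℝ :=
  ∑ j : ZMod N, ∫ s in (0:ℝ)..h, (p j).eval s ^ 2

/-- The numerical flux `H_j` of the non-staggered energy-based DG method. -/
noncomputable def Hflux (N : ℕ) [NeZero N] (h c α β : ℝ)
    (w v : ZMod N → Polynomial ℝ) (j : ZMod N) : ℝ :=
  α * (v (j - 1)).eval h + (1 - α) * (v j).eval 0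
    - β * c ^ 2 * ((w (j - 1)).eval h - (w j).eval 0)

/-- The numerical flux `G_j` of the non-staggered energy-based DG method. -/
noncomputable def Gflux (N : ℕ) [NeZero N] (h c α τ : ℝ)
    (w v : ZMod N → Polynomial ℝ) (j : ZMod N) : ℝ :=
  (1 - α) * (w (j - 1)).eval h + α * (w j).eval 0
    - τ / c ^ 2 * ((v (j - 1)).eval h - (v j).eval 0)

/-- The non-staggered energy-based DG bilinear form `B(w,v;φ,ψ)`. -/
noncomputable def Bform (N : ℕ) [NeZero N] (h c α β τ : ℝ)
    (w v φ ψ : ZMod N → Polynomial ℝ) : ℝ :=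
  c ^ 2 * ∑ j : ZMod N,
    ((∫ s in (0:ℝ)..h,
        ((φ j).eval s * (derivative (v j)).eval s
          - (derivative (ψ j)).eval s * (w j).eval s))
      + (ψ j).eval h * Gflux N h c α τ w v (j + 1)
      - (ψ j).eval 0 * Gflux N h c α τ w v j
      + (φ j).eval h * (Hflux N h c α β w v (j + 1) - (v j).eval h)
      - (φ j).eval 0 * (Hflux N h c α β w v j - (v j).eval 0))


/-- Integration over the unit interval, as a linear functional on polynomials. -/
noncomputable def unitInt : ℝ[X] →ₗ[ℝ] ℝ where
  toFun p := ∫ s in (0:ℝ)..1, p.eval s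
  map_add' p q := by
    simp only [eval_add]
    exact intervalIntegral.integral_add (p.continuous.intervalIntegrable _ _)
      (q.continuous.intervalIntegrable _ _)
  map_smul' a p := by
    simp only [eval_smul, smul_eq_mul, RingHom.id_apply]
    exact intervalIntegral.integral_const_mul _ _

lemma unitInt_apply (p : ℝ[X]) : unitInt p = ∫ s in (0:ℝ)..1, p.eval s := rfl

lemma unitInt_derivative (p : ℝ[X]) : unitInt (derivative p) = p.eval 1 - p.eval 0 := by
  rw [unitInt_apply]
  exact intervalIntegral.integral_eq_sub_of_hasDerivAt (fun x _ => p.hasDerivAt x)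
    ((derivative p).continuous.intervalIntegrable _ _)

lemma unitInt_C_mul (a : ℝ) (p : ℝ[X]) : unitInt (C a * p) = a * unitInt p := by
  rw [← smul_eq_C_mul, map_smul, smul_eq_mul]

lemma unitInt_mono (p q : ℝ[X]) (hpq : ∀ x, p.eval x ≤ q.eval x) : unitInt p ≤ unitInt q := by
  rw [unitInt_apply, unitInt_apply]
  exact intervalIntegral.integral_mono_on (by norm_num) (p.continuous.intervalIntegrable _ _)
      (q.continuous.intervalIntegrable _ _) (fun x _ => hpq x)

lemma unitInt_parts (p q : ℝ[X]) : unitInt (p * derivative q) =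
    p.eval 1 * q.eval 1 - p.eval 0 * q.eval 0 - unitInt (derivative p * q) := by
  have := unitInt_derivative (p * q)
  rw [derivative_mul, map_add, eval_mul, eval_mul] at this
  linarith

/-- The real shifted Legendre polynomial. -/
noncomputable def leg (n : ℕ) : ℝ[X] := (shiftedLegendre n).map (Int.castRingHom ℝ)

lemma unitInt_mul_iterate (n : ℕ) : ∀ (f q : ℝ[X]), (X : ℝ[X]) ^ n ∣ f →
    ((1 : ℝ[X]) - X) ^ n ∣ f → (q = 0 ∨ q.natDegree < n) →
    unitInt (q * derivative^[n] f) = 0 := by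
  induction n with
  | zero =>
    intro f q _ _ hq
    have : q = 0 := by rcases hq with h | h; exacts [h, absurd h (by omega)]
    simp [this]
  | succ n ih =>
    intro f q h0 h1 hq
    have e0 : (derivative^[n] f).eval 0 = 0 := by
      have := pow_sub_dvd_iterate_derivative_of_pow_dvd n h0
      obtain ⟨g, hg⟩ := this
      rw [hg]; simp
    have e1 : (derivative^[n] f).eval 1 = 0 := by
      have := pow_sub_dvd_iterate_derivative_of_pow_dvd n h1
      obtain ⟨g, hg⟩ := this
      rw [hg]; simp
    rw [Function.iterate_succ_apply', unitInt_parts, e0, e1,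
      ih f (derivative q) ((pow_dvd_pow _ (Nat.le_succ n)).trans h0)
        ((pow_dvd_pow _ (Nat.le_succ n)).trans h1) ?_]
    · ring
    · by_cases hd : q.natDegree = 0
      · left
        exact derivative_of_natDegree_zero hd
      · right
        have h1 := natDegree_derivative_lt hd
        rcases hq with h | h
        · simp [h] at hd
        · omega

lemma leg_rodrigues (n : ℕ) : C ((n.factorial : ℝ)) * leg n =
    derivative^[n] (X ^ n * (1 - (X : ℝ[X])) ^ n) := by
  have := congrArg (Polynomial.map (Int.castRingHom ℝ)) (factorial_mul_shiftedLegendre_eq n)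
  rw [← iterate_derivative_map] at this
  simpa [leg] using this

lemma leg_orth (n : ℕ) (q : ℝ[X]) (hq : q = 0 ∨ q.natDegree < n) : unitInt (q * leg n) = 0 := by
  have h := unitInt_mul_iterate n (X ^ n * (1 - (X : ℝ[X])) ^ n) q (dvd_mul_right _ _)
    (dvd_mul_left _ _) hq
  rw [← leg_rodrigues, mul_left_comm, unitInt_C_mul] at h
  have : (n.factorial : ℝ) ≠ 0 := by positivity
  simpa [this] using h

lemma leg_natDegree (n : ℕ) : (leg n).natDegree = n := by
  rw [leg, natDegree_map_eq_of_injective (RingHom.injective_int _), natDegree_shiftedLegendre]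

lemma leg_coeff (n k : ℕ) :
    (leg n).coeff k = (-1) ^ k * n.choose k * (n + k).choose n := by
  rw [leg, coeff_map, coeff_shiftedLegendre]; simp

lemma leg_comp (n : ℕ) : leg n = C ((-1 : ℝ) ^ n) * (leg n).comp (1 - X) := by
  have := congrArg (Polynomial.map (Int.castRingHom ℝ))
    (neg_one_pow_mul_shiftedLegendre_comp_one_sub_X_eq n)
  rw [Polynomial.map_mul, Polynomial.map_comp] at this
  simpa [leg] using this.symm

lemma leg_eval_zero (n : ℕ) : (leg n).eval 0 = 1 := by
  rw [← coeff_zero_eq_eval_zero, leg_coeff]; simp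

lemma leg_eval_one (n : ℕ) : (leg n).eval 1 = (-1) ^ n := by
  rw [leg_comp, eval_mul, eval_comp]; simp [leg_eval_zero]

lemma leg_deriv_zero (n : ℕ) : (derivative (leg n)).eval 0 = -(n * (n + 1)) := by
  rw [← coeff_zero_eq_eval_zero, coeff_derivative, leg_coeff]
  simp
  

lemma leg_deriv_one (n : ℕ) : (derivative (leg n)).eval 1 = (-1) ^ n * (n * (n + 1)) := by
  rw [leg_comp, derivative_C_mul, derivative_comp, eval_mul, eval_mul, eval_comp]
  simp [leg_deriv_zero]

lemma leg_norm (n : ℕ) : unitInt (leg n * leg n) = 1 / (2 * n + 1) := by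
  have h1 := unitInt_derivative (X * (leg n * leg n))
  have h2 : derivative (X * (leg n * leg n)) = C (2 * n + 1 : ℝ) * (leg n * leg n)
      + C 2 * ((X * derivative (leg n) - C (n : ℝ) * leg n) * leg n) := by
    simp only [derivative_mul, derivative_X, C_add, C_mul, map_natCast, map_ofNat, C_1]
    ring
  have h3 : unitInt ((X * derivative (leg n) - C (n : ℝ) * leg n) * leg n) = 0 := by
    apply leg_orth
    rw [or_iff_not_imp_left]
    intro h0
    have : n ≠ 0 := by
      rintro rfl
      apply h0
      have := derivative_of_natDegree_zero (leg_natDegree 0)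
      simp [this]
    rw [natDegree_lt_iff_degree_lt h0, degree_lt_iff_coeff_zero]
    intro m hm
    obtain ⟨k, rfl⟩ : ∃ k, m = k + 1 := ⟨m - 1, by omega⟩
    rw [coeff_sub, coeff_X_mul, coeff_derivative, coeff_C_mul]
    rcases hm.eq_or_lt with h | h
    · rw [h]; push_cast; ring
    · rw [coeff_eq_zero_of_natDegree_lt (p := leg n) (by rw [leg_natDegree]; exact h)]; ring
  rw [h2, map_add, unitInt_C_mul, unitInt_C_mul, h3] at h1
  simp only [eval_mul, eval_X, leg_eval_one] at h1
  rw [← pow_add, ← two_mul, pow_mul] at h1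
  norm_num at h1
  rw [eq_div_iff (by positivity)]
  linarith

lemma leg_orth_ne (m n : ℕ) (hmn : m ≠ n) : unitInt (leg m * leg n) = 0 := by
  rcases lt_or_gt_of_ne hmn with h | h
  · exact leg_orth n _ (Or.inr (by rwa [leg_natDegree]))
  · rw [mul_comm]; exact leg_orth m _ (Or.inr (by rwa [leg_natDegree]))

lemma leg_deriv_norm (n : ℕ) :
    unitInt (derivative (leg n) * derivative (leg n)) = 2 * n * (n + 1) := by
  rw [unitInt_parts, leg_orth, leg_eval_one, leg_eval_zero, leg_deriv_one, leg_deriv_zero]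
  · have : ((-1 : ℝ) ^ n) * (-1) ^ n = 1 := by rw [← mul_pow]; simp
    linear_combination (n * (n + 1) : ℝ) * this
  · by_cases h : derivative (derivative (leg n)) = 0
    · exact Or.inl h
    · right
      have h1 : (leg n).natDegree ≠ 0 := by
        intro h'
        apply h; rw [derivative_of_natDegree_zero h']; simp
      have h2 := natDegree_derivative_lt h1
      have h3 := natDegree_derivative_le (derivative (leg n))
      rw [leg_natDegree] at h2
      omega

lemma leg_expand (q : ℕ) : ∀ p : ℝ[X], p.natDegree ≤ q →
    ∃ a : ℕ → ℝ, p = ∑ n ∈ Finset.range (q + 1), C (a n) * leg n := by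
  induction q with
  | zero =>
    intro p hp
    refine ⟨fun _ => p.coeff 0, ?_⟩
    have h0 : leg 0 = 1 := by
      rw [eq_C_of_natDegree_eq_zero (leg_natDegree 0), leg_coeff]; simp
    rw [Finset.sum_range_one, h0, mul_one]
    exact eq_C_of_natDegree_le_zero hp
  | succ q ih =>
    intro p hp
    set t := p.coeff (q + 1) / (leg (q + 1)).coeff (q + 1) with ht
    have hl : (leg (q + 1)).coeff (q + 1) ≠ 0 := by
      have : (leg (q + 1)) ≠ 0 := by
        intro h
        have := leg_natDegree (q + 1)
        rw [h] at this; simp at this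
      have h2 := leadingCoeff_ne_zero.mpr this
      rwa [leadingCoeff, leg_natDegree] at h2
    obtain ⟨a, ha⟩ := ih (p - C t * leg (q + 1)) (by
      rw [natDegree_le_iff_coeff_eq_zero]
      intro m hm
      rw [coeff_sub, coeff_C_mul]
      rcases (Nat.succ_le_of_lt hm).eq_or_lt with h | h
      · rw [← h, ht, Nat.succ_eq_add_one]; field_simp; ring
      · rw [coeff_eq_zero_of_natDegree_lt (p := leg (q + 1)) (by rw [leg_natDegree]; exact h),
          coeff_eq_zero_of_natDegree_lt (p := p) (by omega)]; ring)
    refine ⟨fun n => if n = q + 1 then t else a n, ?_⟩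
    rw [Finset.sum_range_succ]
    dsimp only
    rw [if_pos rfl, ← sub_eq_iff_eq_add, ha]
    refine Finset.sum_congr rfl fun n hn => ?_
    rw [if_neg]
    rw [Finset.mem_range] at hn; omega

lemma expand_norm (q : ℕ) (a : ℕ → ℝ) :
    unitInt ((∑ n ∈ Finset.range (q + 1), C (a n) * leg n) ^ 2)
      = ∑ n ∈ Finset.range (q + 1), a n ^ 2 / (2 * n + 1) := by
  rw [sq, Finset.sum_mul_sum, map_sum]
  refine Finset.sum_congr rfl fun m hm => ?_
  rw [map_sum, Finset.sum_eq_single m]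
  · rw [show C (a m) * leg m * (C (a m) * leg m) = C (a m * a m) * (leg m * leg m) by
      rw [C_mul]; ring, unitInt_C_mul, leg_norm]; ring
  · intro n _ hn
    rw [show C (a m) * leg m * (C (a n) * leg n) = C (a m * a n) * (leg m * leg n) by
      rw [C_mul]; ring, unitInt_C_mul, leg_orth_ne m n hn.symm]; ring
  · intro h; exact absurd hm h

lemma weighted_cs (s : Finset ℕ) (a b : ℕ → ℝ) :
    (∑ n ∈ s, a n * b n) ^ 2 ≤
      (∑ n ∈ s, a n ^ 2 / (2 * n + 1)) * ∑ n ∈ s, (2 * n + 1) * b n ^ 2 := by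
  refine Finset.sum_sq_le_sum_mul_sum_of_sq_le_mul s (fun i _ => by positivity)
    (fun i _ => by positivity) (fun i _ => le_of_eq ?_)
  field_simp

lemma sum_trace_weights (q : ℕ) : ∑ n ∈ Finset.range (q + 1),
    (2 * (n : ℝ) + 1) = (q + 1) ^ 2 := by
  induction q with
  | zero => simp
  | succ q ih => rw [Finset.sum_range_succ, ih]; push_cast; ring

lemma unit_trace (q : ℕ) (p : ℝ[X]) (hp : p.natDegree ≤ q) (x : ℝ) (hx : x = 0 ∨ x = 1) :
    p.eval x ^ 2 ≤ (q + 1) ^ 2 * unitInt (p ^ 2) := by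
  obtain ⟨a, rfl⟩ := leg_expand q p hp
  rw [expand_norm, eval_finsetSum]
  simp only [eval_mul, eval_C]
  refine (weighted_cs _ _ _).trans (le_of_eq ?_)
  rw [mul_comm]
  congr 1
  have h1 : ∀ n, (leg n).eval x ^ 2 = 1 := by
    intro n
    rcases hx with rfl | rfl
    · simp [leg_eval_zero]
    · rw [leg_eval_one, ← pow_mul, mul_comm, pow_mul]; simp
  simp only [h1, mul_one]
  exact sum_trace_weights q

lemma sum_deriv_weights (q : ℕ) : ∑ n ∈ Finset.range (q + 1),
    (2 * (n : ℝ) + 1) * (2 * n * (n + 1)) = q * (q + 1) ^ 2 * (q + 2) := by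
  induction q with
  | zero => simp
  | succ q ih => rw [Finset.sum_range_succ, ih]; push_cast; ring

lemma unit_inverse (q : ℕ) (p : ℝ[X]) (hp : p.natDegree ≤ q) :
    unitInt (derivative p ^ 2) ≤ 12 * (q : ℝ) ^ 4 * unitInt (p ^ 2) := by
  have hnn : 0 ≤ unitInt (p ^ 2) := by
    have := unitInt_mono 0 (p ^ 2) (fun x => by simp [sq_nonneg])
    simpa using this
  have h1 : unitInt (derivative p ^ 2) ≤ (q * (q + 1) ^ 2 * (q + 2)) * unitInt (p ^ 2) := by
    obtain ⟨a, rfl⟩ := leg_expand q p hp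
    set A := unitInt ((∑ n ∈ Finset.range (q + 1), C (a n) * leg n) ^ 2) with hA
    have := unitInt_mono (derivative (∑ n ∈ Finset.range (q + 1), C (a n) * leg n) ^ 2)
      (C A * ∑ n ∈ Finset.range (q + 1),
        C (2 * n + 1 : ℝ) * (derivative (leg n) * derivative (leg n))) (fun x => by
          rw [hA, expand_norm, eval_pow, derivative_sum]
          simp only [derivative_C_mul, eval_finsetSum, eval_mul, eval_C, ← pow_two (eval _ _)]
          exact weighted_cs _ _ _)
    refine this.trans (le_of_eq ?_)
    rw [unitInt_C_mul, map_sum]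
    simp only [unitInt_C_mul, leg_deriv_norm, sum_deriv_weights]
    ring
  refine h1.trans (mul_le_mul_of_nonneg_right ?_ hnn)
  rcases Nat.eq_zero_or_pos q with rfl | h
  · simp
  · have : (1 : ℝ) ≤ q := by exact_mod_cast h
    obtain ⟨t, ht⟩ : ∃ t : ℝ, (q : ℝ) = 1 + t := ⟨q - 1, by ring⟩
    have ht0 : 0 ≤ t := by linarith
    rw [ht]
    have : 0 ≤ 12 * (1 + t) ^ 4 - (1 + t) * (1 + t + 1) ^ 2 * (1 + t + 2) := by
      ring_nf; positivity
    linarith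

lemma scale_int (h : ℝ) (p : ℝ[X]) :
    ∫ s in (0:ℝ)..h, p.eval s ^ 2 = h * unitInt ((p.comp (C h * X)) ^ 2) := by
  rw [unitInt_apply]
  simp only [eval_pow, eval_comp, eval_mul, eval_C, eval_X]
  have := intervalIntegral.smul_integral_comp_mul_left (a := 0) (b := 1)
    (f := fun x => p.eval x ^ 2) h
  simp only [smul_eq_mul, mul_zero, mul_one] at this
  exact this.symm

lemma comp_deg (h : ℝ) (q : ℕ) (p : ℝ[X]) (hp : p.natDegree ≤ q) :
    (p.comp (C h * X)).natDegree ≤ q := by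
  refine natDegree_comp_le.trans ?_
  calc _ ≤ p.natDegree * 1 := Nat.mul_le_mul_left _ ((natDegree_C_mul_le _ _).trans natDegree_X_le)
    _ ≤ q := by omega

lemma trace_bound (h : ℝ) (hh : 0 < h) (q : ℕ) (p : ℝ[X]) (hp : p.natDegree ≤ q)
    (x : ℝ) (hx : x = 0 ∨ x = h) :
    p.eval x ^ 2 ≤ (q + 1) ^ 2 / h * ∫ s in (0:ℝ)..h, p.eval s ^ 2 := by
  rw [scale_int]
  have h1 : ∃ y : ℝ, (y = 0 ∨ y = 1) ∧ x = h * y := by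
    rcases hx with rfl | rfl
    · exact ⟨0, by simp⟩
    · exact ⟨1, by simp⟩
  obtain ⟨y, hy, rfl⟩ := h1
  have := unit_trace q _ (comp_deg h q p hp) y hy
  simp only [eval_comp, eval_mul, eval_C, eval_X] at this
  refine this.trans (le_of_eq ?_)
  field_simp

lemma inverse_bound (h : ℝ) (hh : 0 < h) (q : ℕ) (p : ℝ[X]) (hp : p.natDegree ≤ q) :
    ∫ s in (0:ℝ)..h, (derivative p).eval s ^ 2 ≤
      12 * (q : ℝ) ^ 4 / h ^ 2 * ∫ s in (0:ℝ)..h, p.eval s ^ 2 := by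
  rw [scale_int, scale_int]
  have := unit_inverse q _ (comp_deg h q p hp)
  rw [derivative_comp, show derivative (C h * X) = C h by simp, mul_pow, ← C_pow,
    unitInt_C_mul] at this
  rw [div_mul_eq_mul_div, le_div_iff₀ (by positivity)]
  nlinarith

section
variable (N : ℕ) [NeZero N]

lemma brokenNormSq_nonneg (h : ℝ) (hh : 0 < h) (p : ZMod N → ℝ[X]) :
    0 ≤ brokenNormSq N h p :=
  Finset.sum_nonneg fun _ _ => intervalIntegral.integral_nonneg hh.le fun _ _ => sq_nonneg _

lemma broken_cs (h : ℝ) (hh : 0 < h) (f g : ZMod N → ℝ[X]) :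
    |∑ j, ∫ s in (0:ℝ)..h, (f j).eval s * (g j).eval s| ≤
      √(brokenNormSq N h f) * √(brokenNormSq N h g) := by
  have key : ∀ x : ℝ, 0 ≤ brokenNormSq N h f * (x * x) +
      (2 * ∑ j, ∫ s in (0:ℝ)..h, (f j).eval s * (g j).eval s) * x + brokenNormSq N h g := by
    intro x
    refine (brokenNormSq_nonneg N h hh (fun j => C x * f j + g j)).trans (le_of_eq ?_)
    simp only [brokenNormSq]
    rw [Finset.sum_mul, Finset.mul_sum, Finset.sum_mul, ← Finset.sum_add_distrib,
      ← Finset.sum_add_distrib]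
    refine Finset.sum_congr rfl fun j _ => ?_
    have i1 : IntervalIntegrable (fun s => (f j).eval s ^ 2 * (x * x)) MeasureTheory.volume 0 h :=
      (((f j).continuous.pow 2).mul continuous_const).intervalIntegrable _ _
    have i2 : IntervalIntegrable (fun s => 2 * ((f j).eval s * (g j).eval s) * x)
        MeasureTheory.volume 0 h :=
      ((continuous_const.mul ((f j).continuous.mul (g j).continuous)).mul
        continuous_const).intervalIntegrable _ _
    have i3 : IntervalIntegrable (fun s => (g j).eval s ^ 2) MeasureTheory.volume 0 h :=
      ((g j).continuous.pow 2).intervalIntegrable _ _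
    rw [← intervalIntegral.integral_mul_const, ← intervalIntegral.integral_const_mul,
      ← intervalIntegral.integral_mul_const, ← intervalIntegral.integral_add i1 i2,
      ← intervalIntegral.integral_add (i1.add i2) i3]
    refine intervalIntegral.integral_congr fun s _ => ?_
    simp only [eval_add, eval_mul, eval_C]
    ring
  have hd := discrim_le_zero key
  rw [discrim] at hd
  rw [← Real.sqrt_mul (brokenNormSq_nonneg N h hh f)]
  apply Real.abs_le_sqrt
  nlinarith

lemma broken_inverse (h : ℝ) (hh : 0 < h) (q : ℕ) (p : ZMod N → ℝ[X])
    (hp : ∀ j, (p j).natDegree ≤ q) :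
    √(brokenNormSq N h (fun j => derivative (p j))) ≤
      2 * √3 * (q : ℝ) ^ 2 / h * √(brokenNormSq N h p) := by
  rw [Real.sqrt_le_left (by positivity), mul_pow, Real.sq_sqrt (brokenNormSq_nonneg N h hh p)]
  have : (2 * √3 * (q : ℝ) ^ 2 / h) ^ 2 = 12 * (q : ℝ) ^ 4 / h ^ 2 := by
    rw [div_pow, mul_pow, mul_pow, Real.sq_sqrt (by norm_num)]; ring
  rw [this, brokenNormSq, brokenNormSq, Finset.mul_sum]
  exact Finset.sum_le_sum fun j _ => inverse_bound h hh q (p j) (hp j)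

lemma broken_vol (h : ℝ) (hh : 0 < h) (q : ℕ) (f p : ZMod N → ℝ[X])
    (hp : ∀ j, (p j).natDegree ≤ q) :
    |∑ j, ∫ s in (0:ℝ)..h, (f j).eval s * (derivative (p j)).eval s| ≤
      2 * √3 * (q : ℝ) ^ 2 / h * (√(brokenNormSq N h f) * √(brokenNormSq N h p)) := by
  refine (broken_cs N h hh f (fun j => derivative (p j))).trans ?_
  have := mul_le_mul_of_nonneg_left (broken_inverse N h hh q p hp)
    (Real.sqrt_nonneg (brokenNormSq N h f))
  linarith

/-- A linear combination of the two traces at a node. -/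
noncomputable def nodeComb (h a b : ℝ) (p : ZMod N → ℝ[X]) (j : ZMod N) : ℝ :=
  a * (p (j - 1)).eval h + b * (p j).eval 0

lemma node_sq (h : ℝ) (hh : 0 < h) (a b : ℝ) (q : ℕ) (p : ZMod N → ℝ[X])
    (hp : ∀ j, (p j).natDegree ≤ q) :
    √(∑ j, nodeComb N h a b p j ^ 2) ≤
      (|a| + |b|) * (q + 1) / √h * √(brokenNormSq N h p) := by
  rw [Real.sqrt_le_left (by positivity), mul_pow, Real.sq_sqrt (brokenNormSq_nonneg N h hh p),
    div_pow, Real.sq_sqrt hh.le]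
  have t1 : ∑ j, (p (j - 1)).eval h ^ 2 ≤ (q + 1) ^ 2 / h * brokenNormSq N h p := by
    have e := Equiv.sum_comp (Equiv.subRight (1 : ZMod N)) (fun j => (p j).eval h ^ 2)
    simp only [Equiv.subRight_apply] at e
    rw [e, brokenNormSq, Finset.mul_sum]
    exact Finset.sum_le_sum fun j _ => trace_bound h hh q (p j) (hp j) h (Or.inr rfl)
  have t2 : ∑ j, (p j).eval 0 ^ 2 ≤ (q + 1) ^ 2 / h * brokenNormSq N h p := by
    rw [brokenNormSq, Finset.mul_sum]
    exact Finset.sum_le_sum fun j _ => trace_bound h hh q (p j) (hp j) 0 (Or.inl rfl)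
  have t3 : ∑ j, nodeComb N h a b p j ^ 2 ≤ (|a| + |b|) *
      (|a| * ∑ j, (p (j - 1)).eval h ^ 2 + |b| * ∑ j, (p j).eval 0 ^ 2) := by
    rw [Finset.mul_sum, Finset.mul_sum, ← Finset.sum_add_distrib, Finset.mul_sum]
    refine Finset.sum_le_sum fun j _ => ?_
    rw [nodeComb]
    generalize (p (j - 1)).eval h = x
    generalize (p j).eval 0 = y
    have e1 : (a * x + b * y) ^ 2 ≤ (|a| * |x| + |b| * |y|) ^ 2 := by
      rw [← sq_abs]
      gcongr
      refine (abs_add_le _ _).trans ?_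
      rw [abs_mul, abs_mul]
    rw [← sq_abs x, ← sq_abs y]
    nlinarith [mul_nonneg (mul_nonneg (abs_nonneg a) (abs_nonneg b)) (sq_nonneg (|x| - |y|))]
  refine t3.trans ?_
  have u1 := mul_le_mul_of_nonneg_left t1 (abs_nonneg a)
  have u2 := mul_le_mul_of_nonneg_left t2 (abs_nonneg b)
  have u3 := mul_le_mul_of_nonneg_left (add_le_add u1 u2) (by positivity : 0 ≤ |a| + |b|)
  refine u3.trans (le_of_eq ?_)
  ring

lemma node_cs (h : ℝ) (hh : 0 < h) (a b a' b' : ℝ) (q q' : ℕ) (p r : ZMod N → ℝ[X])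
    (hp : ∀ j, (p j).natDegree ≤ q) (hr : ∀ j, (r j).natDegree ≤ q') :
    |∑ j, nodeComb N h a b p j * nodeComb N h a' b' r j| ≤
      (|a| + |b|) * (|a'| + |b'|) * (q + 1) * (q' + 1) / h *
        (√(brokenNormSq N h p) * √(brokenNormSq N h r)) := by
  have h1 : |∑ j, nodeComb N h a b p j * nodeComb N h a' b' r j| ≤
      √(∑ j, nodeComb N h a b p j ^ 2) * √(∑ j, nodeComb N h a' b' r j ^ 2) := by
    rw [← Real.sqrt_mul (Finset.sum_nonneg fun _ _ => sq_nonneg _)]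
    exact Real.abs_le_sqrt (Finset.sum_mul_sq_le_sq_mul_sq _ _ _)
  refine h1.trans ((mul_le_mul (node_sq N h hh a b q p hp) (node_sq N h hh a' b' q' r hr)
    (Real.sqrt_nonneg _) (by positivity)).trans (le_of_eq ?_))
  have : √h * √h = h := Real.mul_self_sqrt hh.le
  have h0 : √h ≠ 0 := (Real.sqrt_pos.mpr hh).ne'
  rw [mul_mul_mul_comm, div_mul_div_comm, this]
  ring

lemma Bform_eq (h c α β τ : ℝ) (hc : 0 < c) (w v φ ψ : ZMod N → ℝ[X]) :
    Bform N h c α β τ w v φ ψ = c ^ 2 * (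
      (∑ j, ∫ s in (0:ℝ)..h, (φ j).eval s * (derivative (v j)).eval s)
      - (∑ j, ∫ s in (0:ℝ)..h, (w j).eval s * (derivative (ψ j)).eval s)
      + (∑ j, nodeComb N h 1 (-1) ψ j * nodeComb N h (1 - α) α w j)
      - τ / c ^ 2 * (∑ j, nodeComb N h 1 (-1) v j * nodeComb N h 1 (-1) ψ j)
      - (∑ j, nodeComb N h 1 (-1) v j * nodeComb N h (1 - α) α φ j)
      - β * c ^ 2 * (∑ j, nodeComb N h 1 (-1) w j * nodeComb N h 1 (-1) φ j)) := by
  rw [Bform]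
  congr 1
  have s1 : ∑ j, (ψ j).eval h * Gflux N h c α τ w v (j + 1) =
      ∑ j, (ψ (j - 1)).eval h * Gflux N h c α τ w v j := by
    rw [← Equiv.sum_comp (Equiv.subRight (1 : ZMod N))]
    simp
  have s2 : ∑ j, (φ j).eval h * (Hflux N h c α β w v (j + 1) - (v j).eval h) =
      ∑ j, (φ (j - 1)).eval h * (Hflux N h c α β w v j - (v (j - 1)).eval h) := by
    rw [← Equiv.sum_comp (Equiv.subRight (1 : ZMod N))]
    simp
  rw [Finset.sum_sub_distrib, Finset.sum_add_distrib, Finset.sum_sub_distrib,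
    Finset.sum_add_distrib, s1, s2, Finset.mul_sum, Finset.mul_sum]
  simp only [← Finset.sum_sub_distrib, ← Finset.sum_add_distrib]
  refine Finset.sum_congr rfl fun j _ => ?_
  have i1 : IntervalIntegrable (fun s => (φ j).eval s * (derivative (v j)).eval s)
      MeasureTheory.volume 0 h :=
    ((φ j).continuous.mul (derivative (v j)).continuous).intervalIntegrable _ _
  have i2 : IntervalIntegrable (fun s => (derivative (ψ j)).eval s * (w j).eval s)
      MeasureTheory.volume 0 h :=
    ((derivative (ψ j)).continuous.mul (w j).continuous).intervalIntegrable _ _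
  rw [intervalIntegral.integral_sub i1 i2]
  simp only [mul_comm (eval _ (derivative (ψ j)))]
  simp only [nodeComb, Gflux, Hflux]
  ring

end

/-- Theorem 1: operator bound for the non-staggered energy-based DG method. -/
theorem nonstaggered_operator_bound
    (N : ℕ) [NeZero N] (hN : 1 ≤ N) (h c : ℝ) (hh : 0 < h) (hc : 0 < c)
    (qu qv : ℕ) (hqu : 1 ≤ qu) (α β τ : ℝ) (hβ : 0 ≤ β) (hτ : 0 ≤ τ)
    (w φ v ψ : ZMod N → Polynomial ℝ)
    (hw : ∀ j, (w j).natDegree ≤ qu - 1) (hφ : ∀ j, (φ j).natDegree ≤ qu - 1)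
    (hv : ∀ j, (v j).natDegree ≤ qv) (hψ : ∀ j, (ψ j).natDegree ≤ qv) :
    Bform N h c α β τ w v φ ψ ≤
      c / h * (2 * Real.sqrt 3 * max (((qu : ℝ) - 1) ^ 2) ((qv : ℝ) ^ 2)
          + 2 * (2 * max (c * β * (qu : ℝ) ^ 2) (τ / c * ((qv : ℝ) + 1) ^ 2)
              + (|α| + |1 - α|) * ((qv : ℝ) + 1) * (qu : ℝ)))
        * Real.sqrt (c ^ 2 * brokenNormSq N h w + brokenNormSq N h v)
        * Real.sqrt (c ^ 2 * brokenNormSq N h φ + brokenNormSq N h ψ) := by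
  obtain ⟨m, rfl⟩ : ∃ m, qu = m + 1 := ⟨qu - 1, by omega⟩
  simp only [Nat.add_sub_cancel] at hw hφ
  rw [Bform_eq N h c α β τ hc w v φ ψ]
  have b1 := (abs_le.mp (broken_vol N h hh qv φ v hv)).2
  have b2 := (abs_le.mp (broken_vol N h hh qv w ψ hψ)).1
  have b3 := (abs_le.mp (node_cs N h hh 1 (-1) (1 - α) α qv m ψ w hψ hw)).2
  have b4 := (abs_le.mp (node_cs N h hh 1 (-1) 1 (-1) qv qv v ψ hv hψ)).1
  have b5 := (abs_le.mp (node_cs N h hh 1 (-1) (1 - α) α qv m v φ hv hφ)).1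
  have b6 := (abs_le.mp (node_cs N h hh 1 (-1) 1 (-1) m m w φ hw hφ)).1
  have hW := Real.sq_sqrt (brokenNormSq_nonneg N h hh w)
  have hV := Real.sq_sqrt (brokenNormSq_nonneg N h hh v)
  have hF := Real.sq_sqrt (brokenNormSq_nonneg N h hh φ)
  have hP := Real.sq_sqrt (brokenNormSq_nonneg N h hh ψ)
  have nW := Real.sqrt_nonneg (brokenNormSq N h w)
  have nV := Real.sqrt_nonneg (brokenNormSq N h v)
  have nF := Real.sqrt_nonneg (brokenNormSq N h φ)
  have nP := Real.sqrt_nonneg (brokenNormSq N h ψ)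
  rw [← hW, ← hV, ← hF, ← hP]
  generalize √(brokenNormSq N h w) = a at *
  generalize √(brokenNormSq N h v) = b at *
  generalize √(brokenNormSq N h φ) = d at *
  generalize √(brokenNormSq N h ψ) = e at *
  clear hW hV hF hP
  generalize (∑ j, ∫ s in (0:ℝ)..h, (φ j).eval s * (derivative (v j)).eval s) = S1 at *
  generalize (∑ j, ∫ s in (0:ℝ)..h, (w j).eval s * (derivative (ψ j)).eval s) = S2 at *
  generalize (∑ j, nodeComb N h 1 (-1) ψ j * nodeComb N h (1 - α) α w j) = S3 at *
  generalize (∑ j, nodeComb N h 1 (-1) v j * nodeComb N h 1 (-1) ψ j) = S4 at *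
  generalize (∑ j, nodeComb N h 1 (-1) v j * nodeComb N h (1 - α) α φ j) = S5 at *
  generalize (∑ j, nodeComb N h 1 (-1) w j * nodeComb N h 1 (-1) φ j) = S6 at *
  have p1 : c * a * (c * d) + b * e ≤
      √(c ^ 2 * a ^ 2 + b ^ 2) * √(c ^ 2 * d ^ 2 + e ^ 2) := by
    rw [← Real.sqrt_mul (by positivity)]
    apply Real.le_sqrt_of_sq_le
    nlinarith [sq_nonneg (c * a * e - b * (c * d))]
  have p2 : c * a * e + b * (c * d) ≤
      √(c ^ 2 * a ^ 2 + b ^ 2) * √(c ^ 2 * d ^ 2 + e ^ 2) := by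
    rw [← Real.sqrt_mul (by positivity)]
    apply Real.le_sqrt_of_sq_le
    nlinarith [sq_nonneg (c * a * (c * d) - b * e)]
  rw [mul_assoc (c / h * _)]
  generalize √(c ^ 2 * a ^ 2 + b ^ 2) * √(c ^ 2 * d ^ 2 + e ^ 2) = P at *
  have n2 : |(1:ℝ)| + |(-1:ℝ)| = 2 := by norm_num
  rw [n2] at b3 b4 b5 b6
  push_cast
  have hm : (m : ℝ) + 1 - 1 = m := by ring
  rw [hm]
  set A := |α| + |1 - α| with hA
  rw [add_comm |1 - α| |α|, ← hA] at b3 b5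
  have hA0 : 0 ≤ A := by positivity
  set M1 := max ((m : ℝ) ^ 2) ((qv : ℝ) ^ 2) with hM1
  set M2 := max (c * β * ((m : ℝ) + 1) ^ 2) (τ / c * ((qv : ℝ) + 1) ^ 2) with hM2
  have m1 : (qv : ℝ) ^ 2 ≤ M1 := le_max_right _ _
  have m2 : c * β * ((m : ℝ) + 1) ^ 2 ≤ M2 := le_max_left _ _
  have m3 : τ / c * ((qv : ℝ) + 1) ^ 2 ≤ M2 := le_max_right _ _
  have hM10 : 0 ≤ M1 := (sq_nonneg _).trans m1
  have hM20 : 0 ≤ M2 := le_trans (by positivity) m2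
  have b4' := mul_le_mul_of_nonneg_left b4 (by positivity : 0 ≤ τ / c ^ 2)
  have b6' := mul_le_mul_of_nonneg_left b6 (by positivity : 0 ≤ β * c ^ 2)
  have hsum : S1 - S2 + S3 - τ / c ^ 2 * S4 - S5 - β * c ^ 2 * S6 ≤
      2 * √3 * (qv : ℝ) ^ 2 / h * (d * b) + 2 * √3 * (qv : ℝ) ^ 2 / h * (a * e)
      + 2 * A * (qv + 1) * (m + 1) / h * (e * a)
      + τ / c ^ 2 * (2 * 2 * (qv + 1) * (qv + 1) / h * (b * e))
      + 2 * A * (qv + 1) * (m + 1) / h * (b * d)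
      + β * c ^ 2 * (2 * 2 * (m + 1) * (m + 1) / h * (a * d)) := by linarith
  have hsum' := mul_le_mul_of_nonneg_left hsum (by positivity : 0 ≤ c ^ 2)
  refine hsum'.trans ?_
  have k1 : 2 * √3 * (qv : ℝ) ^ 2 * (c * a * e + b * (c * d)) ≤ 2 * √3 * M1 * P := by
    gcongr
  have k2 : 2 * A * ((qv : ℝ) + 1) * (m + 1) * (c * a * e + b * (c * d)) ≤
      2 * A * ((qv : ℝ) + 1) * (m + 1) * P := by
    gcongr
  have k3 : c * β * ((m : ℝ) + 1) ^ 2 * (c * a * (c * d))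
      + τ / c * ((qv : ℝ) + 1) ^ 2 * (b * e) ≤ M2 * P := by
    calc _ ≤ M2 * (c * a * (c * d)) + M2 * (b * e) := by gcongr
      _ = M2 * (c * a * (c * d) + b * e) := by ring
      _ ≤ M2 * P := by gcongr
  have k4 := mul_le_mul_of_nonneg_left (add_le_add (add_le_add k1 k2)
    (mul_le_mul_of_nonneg_left k3 (by norm_num : (0:ℝ) ≤ 4))) (by positivity : 0 ≤ c / h)
  refine (le_of_eq ?_).trans (k4.trans (le_of_eq ?_))
  · field_simp
    ring
  · ring
end

section
/- Bound on the volume terms in the proof of Theorem 2: With the notation of the context, define Θ_{u,1} = c Σ_{j ∈ ZMod N} ( ∫_{h/4}^{h/2} |c·φ_j(s+h/2)·v_{j+1}′(s)| ds + ∫_{h/2}^{3h/4} |c·φ_{j+1}(s−h/2)·v_{j+1}′(s)| ds + ∫_{h/4}^{h/2} |c·φ_j′(s)·v_j(s+h/2)| ds + ∫_{h/2}^{3h/4} |c·φ_j′(s)·v_{j+1}(s−h/2)| ds ) and Θ_{v,1} = c Σ_{j ∈ ZMod N} ( ∫_{h/4}^{h/2} |ψ_j(s+h/2)·c·w_j′(s)|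 ds + ∫_{h/2}^{3h/4} |ψ_{j+1}(s−h/2)·c·w_j′(s)| ds + ∫_{h/4}^{h/2} |ψ_{j+1}′(s)·c·w_j(s+h/2)| ds + ∫_{h/2}^{3h/4} |ψ_{j+1}′(s)·c·w_{j+1}(s−h/2)| ds ). Then Θ_{u,1} + Θ_{v,1} ≤ (c/h) · ((8√3+4)/3) · (q_u + q_v − 1) · (c²‖w‖² + ‖v‖²)^{1/2} · (c²‖φ‖² + ‖ψ‖²)^{1/2}. -/
open Polynomial

namespace Stag

lemma poly_ii (p : Polynomial ℝ) (a b : ℝ) :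
    IntervalIntegrable (fun s => p.eval s) MeasureTheory.volume a b :=
  p.continuous.intervalIntegrable a b

/-- the integral over `[0,h]` as a linear functional -/
noncomputable def I (h : ℝ) : Polynomial ℝ →ₗ[ℝ] ℝ where
  toFun p := ∫ s in (0:ℝ)..h, p.eval s
  map_add' p q := by
    simp only [eval_add]
    exact intervalIntegral.integral_add (poly_ii p _ _) (poly_ii q _ _)
  map_smul' r p := by
    simp [eval_smul]

lemma I_apply (h : ℝ) (p : Polynomial ℝ) : I h p = ∫ s in (0:ℝ)..h, p.eval s := rfl

lemma I_derivative (h : ℝ) (p : Polynomial ℝ) :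
    I h (derivative p) = p.eval h - p.eval 0 := by
  rw [I_apply]
  exact intervalIntegral.integral_eq_sub_of_hasDerivAt (fun x _ => p.hasDerivAt x)
    (poly_ii _ _ _)

lemma I_sq_nonneg (h : ℝ) (hh : 0 < h) (p : Polynomial ℝ) : 0 ≤ I h (p * p) := by
  rw [I_apply]
  apply intervalIntegral.integral_nonneg hh.le
  intro x _
  rw [eval_mul]; exact mul_self_nonneg _

lemma I_sq_eq_zero (h : ℝ) (hh : 0 < h) (p : Polynomial ℝ) (hp : I h (p * p) = 0) :
    p = 0 := by
  by_contra hne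
  have hx : ∃ x ∈ Set.Icc (0:ℝ) h, p.eval x ≠ 0 := by
    by_contra hcon
    push Not at hcon
    apply hne
    apply Polynomial.eq_zero_of_infinite_isRoot
    exact (Set.Icc_infinite hh).mono (fun x hx => hcon x hx)
  obtain ⟨x, hx, hpx⟩ := hx
  have : 0 < I h (p * p) := by
    rw [I_apply]
    apply intervalIntegral.integral_pos hh (p * p).continuous.continuousOn
    · intro y _
      rw [eval_mul]; exact mul_self_nonneg _
    · exact ⟨x, hx, by rw [eval_mul]; exact mul_self_pos.mpr hpx⟩
  linarith

/-- the L² bilinear form -/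
noncomputable def B (h : ℝ) : LinearMap.BilinForm ℝ (Polynomial ℝ) :=
  (LinearMap.mul ℝ (Polynomial ℝ)).compr₂ (I h)

lemma B_apply (h : ℝ) (p q : Polynomial ℝ) : B h p q = I h (p * q) := rfl

lemma decomp (h : ℝ) (hh : 0 < h) (n : ℕ) (p : Polynomial ℝ) :
    ∃ r l : Polynomial ℝ, r + l = p ∧ r ∈ degreeLT ℝ n ∧
      ∀ q ∈ degreeLT ℝ n, I h (q * l) = 0 := by
  have : FiniteDimensional ℝ (degreeLT ℝ n) :=
    Module.Finite.equiv (degreeLTEquiv ℝ n).symm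
  let T : degreeLT ℝ n →ₗ[ℝ] Module.Dual ℝ (degreeLT ℝ n) := (B h).restrict (degreeLT ℝ n)
  have hT : ∀ x y : degreeLT ℝ n, T x y = I h ((x : Polynomial ℝ) * y) := fun _ _ => rfl
  have hinj : Function.Injective T := by
    rw [injective_iff_map_eq_zero]
    intro x hx
    apply Subtype.ext
    apply I_sq_eq_zero h hh
    rw [← hT, hx]; rfl
  have hsurj : Function.Surjective T :=
    (LinearMap.injective_iff_surjective_of_finrank_eq_finrank
      (Subspace.dual_finrank_eq (K := ℝ) (V := degreeLT ℝ n)).symm).1 hinj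
  obtain ⟨r, hr⟩ := hsurj ((B h p).comp (degreeLT ℝ n).subtype)
  refine ⟨r, p - r, by ring, r.2, fun q hq => ?_⟩
  have h1 : T r ⟨q, hq⟩ = I h (p * q) := by rw [hr]; rfl
  rw [hT] at h1
  rw [mul_sub, map_sub, mul_comm q p, mul_comm q, h1, sub_self]

/-- Legendre operator -/
noncomputable def L (h : ℝ) (p : Polynomial ℝ) : Polynomial ℝ :=
  derivative ((X ^ 2 - C h * X) * derivative p)

lemma I_L (h : ℝ) (p q : Polynomial ℝ) :
    I h (L h p * q) = I h ((C h * X - X ^ 2) * derivative p * derivative q) := by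
  have h1 := I_derivative h ((X ^ 2 - C h * X) * derivative p * q)
  have h2 : derivative ((X ^ 2 - C h * X) * derivative p * q)
      = L h p * q - (C h * X - X ^ 2) * derivative p * derivative q := by
    rw [derivative_mul, L]; ring
  rw [h2, map_sub] at h1
  have h3 : ((X ^ 2 - C h * X) * derivative p * q).eval h
    - ((X ^ 2 - C h * X) * derivative p * q).eval 0 = 0 := by
    simp; left; left; ring
  linarith

lemma L_coeff (h : ℝ) (p : Polynomial ℝ) (m : ℕ) :
    (L h p).coeff m = m * (m + 1) * p.coeff m - h * (m + 1) ^ 2 * p.coeff (m + 1) := by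
  rw [L, coeff_derivative, sub_mul, coeff_sub, mul_assoc, coeff_C_mul, coeff_X_mul, coeff_derivative]
  rcases m with _ | m
  · simp [pow_two, mul_assoc]
  · have : (X ^ 2 * derivative p).coeff (m + 1 + 1) = p.coeff (m + 1) * (m + 1) := by
      rw [show m + 1 + 1 = m + 2 from rfl, coeff_X_pow_mul, coeff_derivative]
    rw [this]; push_cast; ring

lemma mem_lt_iff (p : Polynomial ℝ) (n : ℕ) :
    p ∈ degreeLT ℝ n ↔ ∀ m, n ≤ m → p.coeff m = 0 := by
  rw [mem_degreeLT, degree_lt_iff_coeff_zero]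

lemma L_mem (h : ℝ) (n : ℕ) (p : Polynomial ℝ) (hp : p ∈ degreeLT ℝ n) :
    L h p ∈ degreeLT ℝ n := by
  rw [mem_lt_iff] at *
  intro m hm
  rw [L_coeff, hp m hm, hp (m + 1) (by omega)]; ring

lemma L_sub_mem (h : ℝ) (n : ℕ) (p : Polynomial ℝ) (hp : p ∈ degreeLT ℝ (n + 1)) :
    L h p - C ((n : ℝ) * (n + 1)) * p ∈ degreeLT ℝ n := by
  rw [mem_lt_iff] at *
  intro m hm
  rw [coeff_sub, coeff_C_mul, L_coeff, hp (m + 1) (by omega)]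
  rcases Nat.eq_or_lt_of_le hm with rfl | hm
  · ring
  · rw [hp m hm]; ring

lemma L_bound (h : ℝ) (hh : 0 < h) (n : ℕ) : ∀ p ∈ degreeLT ℝ (n + 1),
    I h (L h p * p) ≤ n * (n + 1) * I h (p * p) := by
  have main : ∀ n : ℕ, (∀ p ∈ degreeLT ℝ n, I h (L h p * p) ≤ n * (n + 1) * I h (p * p)) →
      ∀ p ∈ degreeLT ℝ (n + 1), I h (L h p * p) ≤ n * (n + 1) * I h (p * p) := by
    intro n ih p hp
    obtain ⟨r, l, rfl, hr, hl⟩ := decomp h hh n p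
    have hr1 : r ∈ degreeLT ℝ (n + 1) := degreeLT_mono (Nat.le_succ n) hr
    have hl1 : l ∈ degreeLT ℝ (n + 1) := by
      have := Submodule.sub_mem _ hp hr1
      simpa using this
    have e1 := hl _ (L_mem h n r hr)
    have e2 := hl _ (L_sub_mem h n l hl1)
    have e3 := hl r hr
    have e4 : I h (L h l * r) = I h (L h r * l) := by
      rw [I_L, I_L]; congr 1; ring
    have e5 : L h (r + l) = L h r + L h l := by
      simp only [L, derivative_add, mul_add]
    have e6 : I h (L h (r + l) * (r + l)) = I h (L h r * r) + I h (L h l * l) := by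
      rw [e5, show (L h r + L h l) * (r + l) = L h r * r + L h r * l + L h l * r + L h l * l by ring]
      simp only [map_add, e4, e1]; ring
    have e7 : I h ((r + l) * (r + l)) = I h (r * r) + I h (l * l) := by
      rw [show (r + l) * (r + l) = r * r + r * l + r * l + l * l by ring]
      simp only [map_add, e3]; ring
    have e8 : I h (L h l * l) = n * (n + 1) * I h (l * l) := by
      rw [sub_mul, map_sub, mul_assoc, ← smul_eq_C_mul, map_smul, smul_eq_mul] at e2
      linarith
    rw [e6, e7, e8]
    have := ih r hr
    linarith
  induction n with
  | zero =>
    apply main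
    intro p hp
    have : p = 0 := by
      ext m; rw [(mem_lt_iff p 0).1 hp m (Nat.zero_le _)]; simp
    subst this; simp
  | succ n ih =>
    apply main
    intro p hp
    refine (ih p hp).trans ?_
    apply mul_le_mul_of_nonneg_right _ (I_sq_nonneg h hh p)
    push_cast; nlinarith [Nat.cast_nonneg (α := ℝ) n]

/-- interior inverse inequality -/
lemma inverse_ineq (h : ℝ) (hh : 0 < h) (n : ℕ) (p : Polynomial ℝ) (hp : p.natDegree ≤ n) :
    (∫ s in (h / 4)..(3 * h / 4), (derivative p).eval s ^ 2)
      ≤ 32 / 3 * (n / h) ^ 2 * ∫ s in (0:ℝ)..h, p.eval s ^ 2 := by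
  have hm : p ∈ degreeLT ℝ (n + 1) := by
    rw [mem_lt_iff]
    intro m hm
    exact coeff_eq_zero_of_natDegree_lt (by omega)
  have h1 := L_bound h hh n p hm
  rw [I_L] at h1
  have h2 : I h (p * p) = ∫ s in (0:ℝ)..h, p.eval s ^ 2 := by
    rw [I_apply]; congr 1; ext s; rw [eval_mul, sq]
  rw [h2] at h1
  set P := ∫ s in (0:ℝ)..h, p.eval s ^ 2
  have hP : 0 ≤ P := by rw [← h2]; exact I_sq_nonneg h hh p
  have h3 : (∫ s in (h / 4)..(3 * h / 4), ((C h * X - X ^ 2) * derivative p * derivative p).eval s)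
      ≤ I h ((C h * X - X ^ 2) * derivative p * derivative p) := by
    rw [I_apply]
    apply intervalIntegral.integral_mono_interval (by linarith) (by linarith) (by linarith)
    · rw [Filter.EventuallyLE, MeasureTheory.ae_restrict_iff' measurableSet_Ioc]
      refine Filter.Eventually.of_forall fun x hx => ?_
      simp only [eval_mul, eval_sub, eval_C, eval_X, eval_pow, Pi.zero_apply]
      rw [mul_assoc]
      apply mul_nonneg _ (mul_self_nonneg _)
      nlinarith [hx.1, hx.2]
    · exact poly_ii _ _ _
  have h4 : (∫ s in (h / 4)..(3 * h / 4), 3 * h ^ 2 / 16 * (derivative p).eval s ^ 2)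
      ≤ (∫ s in (h / 4)..(3 * h / 4), ((C h * X - X ^ 2) * derivative p * derivative p).eval s) := by
    apply intervalIntegral.integral_mono_on (by linarith)
    · apply Continuous.intervalIntegrable; fun_prop
    · exact poly_ii _ _ _
    · intro x hx
      simp only [eval_mul, eval_sub, eval_C, eval_X, eval_pow]
      rw [mul_assoc _ (eval x _), ← sq]
      apply mul_le_mul_of_nonneg_right _ (sq_nonneg _)
      nlinarith [mul_nonneg (sub_nonneg.2 hx.1) (sub_nonneg.2 hx.2)]
  rw [intervalIntegral.integral_const_mul] at h4
  set D := ∫ s in (h / 4)..(3 * h / 4), (derivative p).eval s ^ 2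
  have h5 : (n : ℝ) * (n + 1) ≤ 2 * n ^ 2 := by
    have : n * (n + 1) ≤ 2 * n ^ 2 := by
      rcases n with _ | n
      · simp
      · nlinarith
    exact_mod_cast this
  have h6 : 3 * h ^ 2 / 16 * D ≤ 2 * n ^ 2 * P :=
    h4.trans (h3.trans (h1.trans (mul_le_mul_of_nonneg_right h5 hP)))
  have h7 : 32 / 3 * ((n : ℝ) / h) ^ 2 * P = (2 * n ^ 2 * P) / (3 * h ^ 2 / 16) := by
    field_simp; ring
  rw [h7, le_div_iff₀ (by positivity)]
  linarith

lemma opt (S A E : ℝ) (hA : 0 ≤ A) (hE : 0 ≤ E)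
    (H : ∀ t : ℝ, 0 < t → 2 * S ≤ t * A + t⁻¹ * E) : S ≤ √A * √E := by
  have hx := Real.sqrt_nonneg A
  have hy := Real.sqrt_nonneg E
  have hA' := Real.sq_sqrt hA
  have hE' := Real.sq_sqrt hE
  set x := √A
  set y := √E
  rw [← hA', ← hE'] at H
  have key : ∀ ε : ℝ, 0 < ε → 2 * S ≤ 2 * (x * y) + ε * (x + y) := by
    intro ε hε
    have h1 := H ((y + ε) / (x + ε)) (by positivity)
    have h2 : (y + ε) / (x + ε) * x ^ 2 ≤ (y + ε) * x := by
      rw [div_mul_eq_mul_div, div_le_iff₀ (by positivity)]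
      nlinarith [mul_nonneg (mul_nonneg (by positivity : 0 ≤ y + ε) hx) hε.le]
    have h3 : ((y + ε) / (x + ε))⁻¹ * y ^ 2 ≤ (x + ε) * y := by
      rw [inv_div, div_mul_eq_mul_div, div_le_iff₀ (by positivity)]
      nlinarith [mul_nonneg (mul_nonneg (by positivity : 0 ≤ x + ε) hy) hε.le]
    linarith
  apply le_of_forall_pos_le_add
  intro δ hδ
  have := key (δ / (x + y + 1)) (by positivity)
  have h2 : δ / (x + y + 1) * (x + y) ≤ δ := by
    rw [div_mul_eq_mul_div, div_le_iff₀ (by positivity)]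
    nlinarith
  linarith

lemma young (f g : ℝ → ℝ) (hf : Continuous f) (hg : Continuous g) (a b t : ℝ) (hab : a ≤ b)
    (ht : 0 < t) :
    2 * (∫ s in a..b, |f s * g s|) ≤ t * (∫ s in a..b, f s ^ 2) + t⁻¹ * ∫ s in a..b, g s ^ 2 := by
  rw [← intervalIntegral.integral_const_mul, ← intervalIntegral.integral_const_mul,
    ← intervalIntegral.integral_const_mul, ← intervalIntegral.integral_add]
  · apply intervalIntegral.integral_mono_on hab
    · apply Continuous.intervalIntegrable; fun_prop
    · apply Continuous.intervalIntegrable; fun_prop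
    · intro x _
      rw [abs_mul, ← sq_abs (f x), ← sq_abs (g x)]
      have : t * |f x| ^ 2 + t⁻¹ * |g x| ^ 2 - 2 * (|f x| * |g x|)
          = t⁻¹ * (t * |f x| - |g x|) ^ 2 := by
        field_simp; ring
      have : 0 ≤ t⁻¹ * (t * |f x| - |g x|) ^ 2 := by positivity
      linarith
  · apply Continuous.intervalIntegrable; fun_prop
  · apply Continuous.intervalIntegrable; fun_prop

lemma norm_nonneg (N : ℕ) [NeZero N] (h : ℝ) (hh : 0 < h) (p : ZMod N → Polynomial ℝ) :
    0 ≤ brokenNormSq N h p :=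
  Finset.sum_nonneg fun j _ => intervalIntegral.integral_nonneg hh.le fun _ _ => sq_nonneg _

lemma sum_shift (N : ℕ) [NeZero N] (f : ZMod N → ℝ) : ∑ j, f (j + 1) = ∑ j, f j :=
  Equiv.sum_comp (Equiv.addRight (1 : ZMod N)) f

lemma norm_shift (N : ℕ) [NeZero N] (h : ℝ) (p : ZMod N → Polynomial ℝ) :
    brokenNormSq N h (fun j => p (j + 1)) = brokenNormSq N h p :=
  sum_shift N (fun j => ∫ s in (0:ℝ)..h, (p j).eval s ^ 2)

lemma norm_smul (N : ℕ) [NeZero N] (h c : ℝ) (p : ZMod N → Polynomial ℝ) :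
    brokenNormSq N h (fun j => C c * p j) = c ^ 2 * brokenNormSq N h p := by
  simp only [brokenNormSq, eval_mul, eval_C, mul_pow, intervalIntegral.integral_const_mul,
    Finset.mul_sum]

lemma pair (N : ℕ) [NeZero N] (h : ℝ) (hh : 0 < h) (n : ℕ) (a b : ZMod N → Polynomial ℝ)
    (hb : ∀ j, (b j).natDegree ≤ n) :
    ∑ j : ZMod N, ((∫ s in (h / 4)..(h / 2), |(a j).eval (s + h / 2) * (derivative (b j)).eval s|)
      + ∫ s in (h / 2)..(3 * h / 4), |(a (j + 1)).eval (s - h / 2) * (derivative (b j)).eval s|)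
    ≤ (8 * √3 + 4) / 3 * (n / h) * (√(brokenNormSq N h a) * √(brokenNormSq N h b)) := by
  have hcont : ∀ (p : Polynomial ℝ) (x y : ℝ),
      IntervalIntegrable (fun s => p.eval s ^ 2) MeasureTheory.volume x y := by
    intro p x y; apply Continuous.intervalIntegrable; fun_prop
  set K := (8 * √3 + 4) / 3 * ((n : ℝ) / h) with hK
  have hK0 : 0 ≤ K := by positivity
  have hKsq : 32 / 3 * ((n : ℝ) / h) ^ 2 ≤ K ^ 2 := by
    rw [hK, mul_pow]
    apply mul_le_mul_of_nonneg_right _ (sq_nonneg _)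
    have := Real.sq_sqrt (show (0:ℝ) ≤ 3 by norm_num)
    nlinarith [Real.sqrt_nonneg 3]
  have hb0 := norm_nonneg N h hh b
  have hE : ∑ j : ZMod N, (∫ s in (h / 4)..(3 * h / 4), (derivative (b j)).eval s ^ 2)
      ≤ K ^ 2 * brokenNormSq N h b := by
    refine le_trans ?_ (mul_le_mul_of_nonneg_right hKsq hb0)
    rw [brokenNormSq, Finset.mul_sum]
    exact Finset.sum_le_sum fun j _ => inverse_ineq h hh n (b j) (hb j)
  have hfin : K * (√(brokenNormSq N h a) * √(brokenNormSq N h b))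
      = √(brokenNormSq N h a) * √(K ^ 2 * brokenNormSq N h b) := by
    rw [Real.sqrt_mul (sq_nonneg K), Real.sqrt_sq hK0]; ring
  rw [hfin]
  apply opt _ _ _ (norm_nonneg N h hh a) (by positivity)
  intro t ht
  have hA : ∑ j : ZMod N, ((∫ s in (3 * h / 4)..h, (a j).eval s ^ 2)
      + ∫ s in (0:ℝ)..(h / 4), (a (j + 1)).eval s ^ 2) ≤ brokenNormSq N h a := by
    rw [Finset.sum_add_distrib,
      sum_shift N (fun j => ∫ s in (0:ℝ)..(h / 4), (a j).eval s ^ 2), ← Finset.sum_add_distrib]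
    apply Finset.sum_le_sum
    intro j _
    have e1 := intervalIntegral.integral_add_adjacent_intervals
      (hcont (a j) 0 (h / 4)) (hcont (a j) (h / 4) (3 * h / 4))
    have e2 := intervalIntegral.integral_add_adjacent_intervals
      (hcont (a j) 0 (3 * h / 4)) (hcont (a j) (3 * h / 4) h)
    have e3 : 0 ≤ ∫ s in (h / 4)..(3 * h / 4), (a j).eval s ^ 2 :=
      intervalIntegral.integral_nonneg (by linarith) fun _ _ => sq_nonneg _
    linarith
  have step : ∀ j : ZMod N,
      2 * ((∫ s in (h / 4)..(h / 2), |(a j).eval (s + h / 2) * (derivative (b j)).eval s|)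
      + ∫ s in (h / 2)..(3 * h / 4), |(a (j + 1)).eval (s - h / 2) * (derivative (b j)).eval s|)
      ≤ t * ((∫ s in (3 * h / 4)..h, (a j).eval s ^ 2)
      + ∫ s in (0:ℝ)..(h / 4), (a (j + 1)).eval s ^ 2)
      + t⁻¹ * (∫ s in (h / 4)..(3 * h / 4), (derivative (b j)).eval s ^ 2) := by
    intro j
    have y1 := young (fun s => (a j).eval (s + h / 2)) (fun s => (derivative (b j)).eval s)
      (by fun_prop) (by fun_prop) (h / 4) (h / 2) t (by linarith) ht
    have y2 := young (fun s => (a (j + 1)).eval (s - h / 2)) (fun s => (derivative (b j)).eval s)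
      (by fun_prop) (by fun_prop) (h / 2) (3 * h / 4) t (by linarith) ht
    have s1 := intervalIntegral.integral_comp_add_right (a := h / 4) (b := h / 2)
      (fun s => (a j).eval s ^ 2) (h / 2)
    have s2 := intervalIntegral.integral_comp_sub_right (a := h / 2) (b := 3 * h / 4)
      (fun s => (a (j + 1)).eval s ^ 2) (h / 2)
    rw [show h / 4 + h / 2 = 3 * h / 4 by ring, show h / 2 + h / 2 = h by ring] at s1
    rw [show h / 2 - h / 2 = 0 by ring, show 3 * h / 4 - h / 2 = h / 4 by ring] at s2
    rw [← intervalIntegral.integral_add_adjacent_intervals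
      (hcont (derivative (b j)) (h / 4) (h / 2)) (hcont (derivative (b j)) (h / 2) (3 * h / 4)),
      ← s1, ← s2]
    linarith
  have hs := Finset.sum_le_sum (s := Finset.univ) fun j _ => step j
  rw [← Finset.mul_sum, Finset.sum_add_distrib (f := fun j => t * _), ← Finset.mul_sum, ← Finset.mul_sum] at hs
  refine hs.trans ?_
  gcongr

end Stag

/-- Bound on the volume terms `Θ_{u,1} + Θ_{v,1}` in the proof of Theorem 2. -/
theorem staggered_volume_terms_bound
    (N : ℕ) [NeZero N] (hN : 1 ≤ N) (h c : ℝ) (hh : 0 < h) (hc : 0 < c)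
    (qu qv : ℕ) (hqu : 1 ≤ qu)
    (w φ v ψ : ZMod N → Polynomial ℝ)
    (hw : ∀ j, (w j).natDegree ≤ qu - 1) (hφ : ∀ j, (φ j).natDegree ≤ qu - 1)
    (hv : ∀ j, (v j).natDegree ≤ qv) (hψ : ∀ j, (ψ j).natDegree ≤ qv)
    (Θu1 Θv1 : ℝ)
    (hΘu1 : Θu1 = c * ∑ j : ZMod N,
        ((∫ s in (h / 4)..(h / 2),
            |c * (φ j).eval (s + h / 2) * (derivative (v (j + 1))).eval s|)
          + (∫ s in (h / 2)..(3 * h / 4),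
              |c * (φ (j + 1)).eval (s - h / 2) * (derivative (v (j + 1))).eval s|)
          + (∫ s in (h / 4)..(h / 2),
              |c * (derivative (φ j)).eval s * (v j).eval (s + h / 2)|)
          + (∫ s in (h / 2)..(3 * h / 4),
              |c * (derivative (φ j)).eval s * (v (j + 1)).eval (s - h / 2)|)))
    (hΘv1 : Θv1 = c * ∑ j : ZMod N,
        ((∫ s in (h / 4)..(h / 2),
            |(ψ j).eval (s + h / 2) * (c * (derivative (w j)).eval s)|)
          + (∫ s in (h / 2)..(3 * h / 4),
              |(ψ (j + 1)).eval (s - h / 2) * (c * (derivative (w j)).eval s)|)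
          + (∫ s in (h / 4)..(h / 2),
              |(derivative (ψ (j + 1))).eval s * (c * (w j).eval (s + h / 2))|)
          + (∫ s in (h / 2)..(3 * h / 4),
              |(derivative (ψ (j + 1))).eval s * (c * (w (j + 1)).eval (s - h / 2))|))) :
    Θu1 + Θv1 ≤
      c / h * ((8 * Real.sqrt 3 + 4) / 3) * ((qu : ℝ) + (qv : ℝ) - 1)
        * Real.sqrt (c ^ 2 * brokenNormSq N h w + brokenNormSq N h v)
        * Real.sqrt (c ^ 2 * brokenNormSq N h φ + brokenNormSq N h ψ) := by
  have p1 := Stag.pair N h hh qv (fun j => C c * φ j) (fun j => v (j + 1)) (fun j => hv _)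
  have p2 := Stag.pair N h hh (qu - 1) v (fun j => C c * φ j)
    (fun j => (natDegree_C_mul_le _ _).trans (hφ j))
  have p3 := Stag.pair N h hh (qu - 1) ψ (fun j => C c * w j)
    (fun j => (natDegree_C_mul_le _ _).trans (hw j))
  have p4 := Stag.pair N h hh qv (fun j => C c * w j) (fun j => ψ (j + 1)) (fun j => hψ _)
  rw [Stag.norm_shift] at p1 p4
  rw [Stag.norm_smul] at p1 p2 p3 p4
  simp only [eval_mul, eval_C, derivative_C_mul] at p1 p2 p3 p4
  rw [Nat.cast_sub hqu, Nat.cast_one] at p2 p3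
  have hqu' : (1:ℝ) ≤ qu := by exact_mod_cast hqu
  have hU : Θu1 ≤ c * ((8 * √3 + 4) / 3 * ((qu + qv - 1) / h)
      * (√(c ^ 2 * brokenNormSq N h φ) * √(brokenNormSq N h v))) := by
    rw [hΘu1]
    apply mul_le_mul_of_nonneg_left _ hc.le
    refine le_trans (le_of_eq ?_) ((add_le_add p1 p2).trans (le_of_eq (by ring)))
    rw [← Finset.sum_add_distrib]
    refine Finset.sum_congr rfl fun j _ => ?_
    simp only [mul_comm (eval _ (v _))]
    ring
  have hV : Θv1 ≤ c * ((8 * √3 + 4) / 3 * ((qu + qv - 1) / h)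
      * (√(c ^ 2 * brokenNormSq N h w) * √(brokenNormSq N h ψ))) := by
    rw [hΘv1]
    apply mul_le_mul_of_nonneg_left _ hc.le
    refine le_trans (le_of_eq ?_) ((add_le_add p3 p4).trans (le_of_eq (by ring)))
    rw [← Finset.sum_add_distrib]
    refine Finset.sum_congr rfl fun j _ => ?_
    simp only [mul_comm (eval _ (derivative (ψ _)))]
    ring
  have nw := mul_nonneg (sq_nonneg c) (Stag.norm_nonneg N h hh w)
  have nφ := mul_nonneg (sq_nonneg c) (Stag.norm_nonneg N h hh φ)
  have nv := Stag.norm_nonneg N h hh v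
  have nψ := Stag.norm_nonneg N h hh ψ
  have cs : √(c ^ 2 * brokenNormSq N h φ) * √(brokenNormSq N h v)
      + √(c ^ 2 * brokenNormSq N h w) * √(brokenNormSq N h ψ)
      ≤ √(c ^ 2 * brokenNormSq N h w + brokenNormSq N h v)
        * √(c ^ 2 * brokenNormSq N h φ + brokenNormSq N h ψ) := by
    rw [← Real.sqrt_mul (add_nonneg nw nv)]
    apply Real.le_sqrt_of_sq_le
    have e1 := Real.sq_sqrt nw
    have e2 := Real.sq_sqrt nφ
    have e3 := Real.sq_sqrt nv
    have e4 := Real.sq_sqrt nψ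
    set x := √(c ^ 2 * brokenNormSq N h w)
    set y := √(c ^ 2 * brokenNormSq N h φ)
    set z := √(brokenNormSq N h v)
    set u := √(brokenNormSq N h ψ)
    rw [← e1, ← e2, ← e3, ← e4]
    nlinarith [sq_nonneg (x * y - z * u)]
  have hK : 0 ≤ c * ((8 * √3 + 4) / 3 * (((qu:ℝ) + qv - 1) / h)) := by
    have : (0:ℝ) ≤ (qu:ℝ) + qv - 1 := by
      have := Nat.cast_nonneg (α := ℝ) qv
      linarith
    positivity
  have := mul_le_mul_of_nonneg_left cs hK
  refine le_trans (add_le_add hU hV) (le_trans (le_of_eq ?_) (this.trans (le_of_eq ?_)))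
  · ring
  · ring
end
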